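/- Let p_k denote the k-th prime number and P(m) = Σ_{k=1}^m (p_k − 1). For each N ∈ ℕ let m = m(N) be the unique natural number with P(m) ≤ N < P(m+1). Then m(N) = (2 + o(1)) · √(N/ln N) as N → ∞. -/

import Mathlib

open Filter Finset
open scoped BigOperators Classical

/-- `starCount ξ N r` = number of indices `n` with `1 ≤ n ≤ N` and `ξ n ∈ [0, r]`
(counted with multiplicity). -/
noncomputable def starCount (ξ : ℕ → ℝ) (N : ℕ) (r : ℝ) : ℕ :=
  ((Finset.Icc 1 N).filter (fun n => ξ n ∈ Set.Icc (0 : ℝ) r)).card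

/-- Star discrepancy of the first `N` terms of the sequence `ξ` (indexed from 1):
`D_N*(ξ) = sup_{0 < r ≤ 1} |A_N(ξ, r)/N − r|`. -/
noncomputable def starDisc (ξ : ℕ → ℝ) (N : ℕ) : ℝ :=
  sSup {d : ℝ | ∃ r : ℝ, 0 < r ∧ r ≤ 1 ∧ d = |(starCount ξ N r : ℝ) / (N : ℝ) - r|}

/-- The `m`-th prime number, 1-indexed: `nthPrime 1 = 2`, `nthPrime 2 = 3`, … -/
noncomputable def nthPrime (m : ℕ) : ℕ := Nat.nth Nat.Prime (m - 1)

/-- `Psum m = ∑_{k=1}^m (p_k − 1)`, the number of terms in the first `m` blocks of `η`. -/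
noncomputable def Psum (m : ℕ) : ℕ := ∑ k ∈ Finset.Icc 1 m, (nthPrime k - 1)

/-- `invMod j p` = the representative in `{0, …, p−1}` of `j⁻¹ (mod p)`. -/
noncomputable def invMod (j p : ℕ) : ℕ := ((j : ZMod p)⁻¹).val

/-- The sequence `η` (indexed from 1), obtained by concatenating over the primes
`p = 2, 3, 5, …` the blocks `(j⁻¹ mod p)/p` for `j = 1, …, p−1`.
For `n ≥ 1`, if `m` is minimal with `n ≤ Psum (m+1)` (so `Psum m < n ≤ Psum (m+1)`),
then `η n` is the `(n − Psum m)`-th element of the block for the prime `nthPrime (m+1)`. -/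
noncomputable def eta (n : ℕ) : ℝ :=
  if h : ∃ m, n ≤ Psum (m + 1) then
    (invMod (n - Psum (Nat.find h)) (nthPrime (Nat.find h + 1)) : ℝ) /
      (nthPrime (Nat.find h + 1) : ℝ)
  else 0


noncomputable def hB (u : ℝ) : ℝ := Chebyshev.psi (Real.exp u) * Real.exp (-u)
noncomputable def hh (u : ℝ) : ℝ := Set.indicator (Set.Ioi 0) (fun u => hB u - 1) u

lemma hB_nonneg (u : ℝ) : 0 ≤ hB u := mul_nonneg (Chebyshev.psi_nonneg _) (Real.exp_pos _).le
lemma hB_le (u : ℝ) : hB u ≤ Real.log 4 + 4 := by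
  have := Chebyshev.psi_le_const_mul_self (Real.exp_pos u).le
  unfold hB
  calc _ ≤ (Real.log 4 + 4) * Real.exp u * Real.exp (-u) := by gcongr
    _ = _ := by rw [mul_assoc, ← Real.exp_add]; simp
lemma hB_meas : Measurable hB := by
  have := Chebyshev.psi_mono.measurable
  unfold hB
  fun_prop
lemma hB_neg {u : ℝ} (hu : u ≤ 0) : hB u = 0 := by
  unfold hB
  rw [Chebyshev.psi_eq_zero_of_le_one (by simpa using hu)]; simp
lemma hh_meas : Measurable hh := (hB_meas.sub_const 1).indicator measurableSet_Ioi
lemma hh_bound (u : ℝ) : |hh u| ≤ Real.log 4 + 4 := by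
  unfold hh
  have h4 : 0 ≤ Real.log 4 := Real.log_nonneg (by norm_num)
  rw [Set.indicator_apply]
  split_ifs
  · rw [abs_le]; constructor <;> linarith [hB_nonneg u, hB_le u]
  · simp; linarith

open ArithmeticFunction in
lemma psi_laplace (s : ℂ) (hs : 1 < s.re) :
    LSeries (fun n => (vonMangoldt n : ℂ)) s = s * ∫ u in Set.Ioi (0:ℝ), (hB u : ℂ) * Complex.exp (-(s-1)*u) := by
  rw [LSeries_eq_mul_integral_of_nonneg (fun n => vonMangoldt n) zero_le_one (by simpa using hs) ?_ (fun n => vonMangoldt_nonneg)]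
  · congr 1
    have := MeasureTheory.integral_image_eq_integral_abs_deriv_smul (s := Set.Ioi (0:ℝ)) (f := Real.exp) (f' := Real.exp) measurableSet_Ioi (fun x _ => (Real.hasDerivAt_exp x).hasDerivWithinAt) Real.exp_injective.injOn (fun t : ℝ => (∑ k ∈ Icc 1 ⌊t⌋₊, ((vonMangoldt k : ℝ) : ℂ)) * (t:ℂ) ^ (-(s + 1)))
    have him : Real.exp '' Set.Ioi 0 = Set.Ioi 1 := by
      ext y; constructor
      · rintro ⟨x, hx, rfl⟩; simpa using hx
      · intro hy
        have hy : 1 < y := hy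
        exact ⟨Real.log y, Real.log_pos hy, Real.exp_log (by linarith)⟩
    rw [him] at this
    rw [this]
    refine MeasureTheory.setIntegral_congr_fun measurableSet_Ioi fun u hu => ?_
    simp only [hB, Chebyshev.psi]
    rw [abs_of_pos (Real.exp_pos u), Complex.real_smul]
    have : (Icc 1 ⌊Real.exp u⌋₊) = Ioc 0 ⌊Real.exp u⌋₊ := by ext; simp; omega
    rw [this]
    push_cast
    rw [Complex.cpow_def_of_ne_zero (by simp), ← Complex.ofReal_exp, ← Complex.ofReal_log (Real.exp_pos u).le, Real.log_exp, Complex.ofReal_exp, mul_left_comm, mul_assoc, ← Complex.exp_add, ← Complex.exp_add]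
    ring_nf
  · refine Asymptotics.IsBigO.of_bound (Real.log 4 + 4) (Eventually.of_forall fun n => ?_)
    have := Chebyshev.psi_le_const_mul_self (x := n) (by positivity)
    have h2 : ∑ k ∈ Icc 1 n, vonMangoldt k = Chebyshev.psi n := by
      simp only [Chebyshev.psi, Nat.floor_natCast]; rfl
    rw [h2]
    simpa [abs_of_nonneg (Chebyshev.psi_nonneg _)] using this

open ArithmeticFunction in
lemma G_exists : ∃ G : ℂ → ℂ, ContinuousOn G {s | 1 ≤ s.re} ∧ ∀ s : ℂ, 1 < s.re →
    G s = LSeries (fun n => (vonMangoldt n : ℂ)) s / s - 1 / (s - 1) := by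
  refine ⟨fun s => (vonMangoldt.LFunctionResidueClassAux (q := 1) 1 s - 1) / s, ?_, ?_⟩
  · refine ((vonMangoldt.continuousOn_LFunctionResidueClassAux (q := 1) 1).sub continuousOn_const).div continuousOn_id ?_
    rintro s hs rfl
    norm_num at hs
  · intro s hs
    have := vonMangoldt.eqOn_LFunctionResidueClassAux (q := 1) (a := 1) isUnit_one hs
    simp only at this ⊢
    rw [this]
    have h1 : s ≠ 0 := by rintro rfl; norm_num at hs
    have h2 : s - 1 ≠ 0 := by
      intro h; rw [sub_eq_zero.1 h] at hs; norm_num at hs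
    have : (fun n : ℕ => (vonMangoldt.residueClass (1 : ZMod 1) n : ℂ)) = fun n => (vonMangoldt n : ℂ) := by
      funext n
      simp [vonMangoldt.residueClass, Set.indicator_apply, Subsingleton.elim (n : ZMod 1) 1]
    rw [this]
    simp
    field_simp
    ring

lemma hh_int {f : ℝ → ℂ} (hf : MeasureTheory.Integrable f) :
    MeasureTheory.Integrable (fun u => (hh u : ℂ) * f u) := by
  refine hf.bdd_mul (c := Real.log 4 + 4) ?_ ?_
  · exact (Complex.measurable_ofReal.comp hh_meas).aestronglyMeasurable
  · exact Eventually.of_forall fun u => by simpa using hh_bound u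

lemma exp_int {s : ℂ} (hs : 1 < s.re) : MeasureTheory.IntegrableOn (fun u : ℝ => Complex.exp (-(s-1)*u)) (Set.Ioi 0) :=
  integrableOn_exp_mul_complex_Ioi (by simp; linarith) 0

lemma hh_laplace (s : ℂ) (hs : 1 < s.re) :
    MeasureTheory.Integrable (fun u => (hh u : ℂ) * Complex.exp (-(s-1)*u)) ∧
    ∫ u, (hh u : ℂ) * Complex.exp (-(s-1)*u) = 
    LSeries (fun n => (ArithmeticFunction.vonMangoldt n : ℂ)) s / s - 1 / (s - 1) := by
  have h1 : s ≠ 0 := by rintro rfl; norm_num at hs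
  have h2 : s - 1 ≠ 0 := by
    intro h; rw [sub_eq_zero.1 h] at hs; norm_num at hs
  have e : (fun u => (hh u : ℂ) * Complex.exp (-(s-1)*u)) = 
      (Set.Ioi 0).indicator (fun u : ℝ => (hB u : ℂ) * Complex.exp (-(s-1)*u) - Complex.exp (-(s-1)*u)) := by
    funext u
    simp only [hh, Set.indicator_apply]
    split_ifs
    · push_cast; ring
    · simp
  have i1 := exp_int hs
  have i2 : MeasureTheory.IntegrableOn (fun u : ℝ => (hB u : ℂ) * Complex.exp (-(s-1)*u)) (Set.Ioi 0) := by
    refine i1.bdd_mul (c := Real.log 4 + 4) ?_ ?_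
    · exact (Complex.measurable_ofReal.comp hB_meas).aestronglyMeasurable
    · exact Eventually.of_forall fun u => by simpa [abs_of_nonneg (hB_nonneg u)] using hB_le u
  rw [e]
  constructor
  · rw [MeasureTheory.integrable_indicator_iff measurableSet_Ioi]
    exact i2.sub i1
  · rw [MeasureTheory.integral_indicator measurableSet_Ioi, MeasureTheory.integral_sub i2 i1, psi_laplace s hs,
      integral_exp_mul_complex_Ioi (by simp; linarith) 0]
    field_simp
    simp


open MeasureTheory in
open scoped FourierTransform in
lemma flip_fourier {f g : ℝ → ℂ} (hf : Integrable f) (hg : Integrable g) :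
    ∫ u, 𝓕 f u * g u = ∫ t, f t * 𝓕 g t := by
  have := VectorFourier.integral_fourierIntegral_smul_eq_flip (L := innerₗ ℝ) (μ := volume) (ν := volume) (e := Real.fourierChar) Real.continuous_fourierChar continuous_inner hf hg
  rw [flip_innerₗ] at this
  exact this

open MeasureTheory in
open scoped FourierTransform in
lemma fourier_mod (φ : ℝ → ℂ) (y u : ℝ) :
    𝓕 (fun t => ((Real.fourierChar (t * y) : Circle) : ℂ) * φ t) u = 𝓕 φ (u - y) := by
  rw [Real.fourier_real_eq, Real.fourier_real_eq]
  congr 1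
  funext t
  simp only [Circle.smul_def, smul_eq_mul, ← mul_assoc, ← Circle.coe_mul, ← AddChar.map_add_eq_mul]
  congr 3
  ring

open MeasureTheory in
open scoped FourierTransform in
lemma fourier_side (φ : ℝ → ℂ) (hc : Continuous φ) (hs : HasCompactSupport φ) (hK : Integrable (𝓕 φ)) :
    Tendsto (fun y : ℝ => ∫ u, (hh u : ℂ) * 𝓕 φ (u - y)) atTop (nhds 0) := by
  obtain ⟨G, hGc, hG⟩ := G_exists
  have hφi : Integrable φ := hc.integrable_of_hasCompactSupport hs
  have hline : ∀ δ t : ℝ, 0 ≤ δ → (1 + (δ : ℂ) + ((2 * Real.pi * t : ℝ) : ℂ) * Complex.I) ∈ {s : ℂ | 1 ≤ s.re} := by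
    intro δ t hδ; simp [hδ]
  -- identity for δ > 0
  have key : ∀ y δ : ℝ, 0 < δ → ∫ u, (hh u : ℂ) * Complex.exp (-(δ*u : ℝ)) * 𝓕 φ (u - y) =
      ∫ t, ((Real.fourierChar (t * y) : Circle) : ℂ) * φ t * G (1 + (δ : ℂ) + ((2 * Real.pi * t : ℝ) : ℂ) * Complex.I) := by
    intro y δ hδ
    have i1 : Integrable (fun t => ((Real.fourierChar (t * y) : Circle) : ℂ) * φ t) := by
      refine hφi.bdd_mul (c := 1) ?_ (Eventually.of_forall fun t => (Circle.norm_coe (Real.fourierChar (t * y))).le)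
      have := Real.continuous_fourierChar
      exact (by fun_prop : Continuous fun t : ℝ => ((Real.fourierChar (t * y) : Circle) : ℂ)).aestronglyMeasurable
    have i2 := (hh_laplace (1 + δ) (by simp [hδ])).1
    have := flip_fourier i1 i2
    simp only [fourier_mod] at this
    calc _ = _ := by
          refine (integral_congr_ae (Eventually.of_forall fun u => ?_)).trans this
          push_cast
          ring_nf
      _ = _ := by
          refine integral_congr_ae (Eventually.of_forall fun t => ?_)
          simp only
          rw [hG _ (by simp [hδ]), ← (hh_laplace _ (by simp [hδ])).2, Real.fourier_real_eq_integral_exp_smul]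
          congr 1
          congr 1
          funext u
          rw [smul_eq_mul, mul_left_comm, ← Complex.exp_add]
          push_cast
          ring_nf
  have lim : ∀ y : ℝ, ∫ u, (hh u : ℂ) * 𝓕 φ (u - y) = 
      ∫ t, ((Real.fourierChar (t * y) : Circle) : ℂ) * φ t * G (1 + ((0:ℝ) : ℂ) + ((2 * Real.pi * t : ℝ) : ℂ) * Complex.I) := by
    intro y
    have iK : Integrable (fun u => 𝓕 φ (u - y)) := hK.comp_sub_right y
    have l1 : Tendsto (fun δ : ℝ => ∫ u, (hh u : ℂ) * Complex.exp (-(δ*u : ℝ)) * 𝓕 φ (u - y)) (nhdsWithin 0 (Set.Ioi 0)) (nhds (∫ u, (hh u : ℂ) * 𝓕 φ (u - y))) := by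
      refine tendsto_integral_filter_of_dominated_convergence (fun u => (Real.log 4 + 4) * ‖𝓕 φ (u - y)‖) ?_ ?_ ?_ ?_
      · refine Eventually.of_forall fun δ => ?_
        refine AEStronglyMeasurable.mul (AEStronglyMeasurable.mul ?_ ?_) iK.1
        · exact (Complex.measurable_ofReal.comp hh_meas).aestronglyMeasurable
        · exact (by fun_prop : Continuous fun u : ℝ => Complex.exp (-(δ*u : ℝ))).aestronglyMeasurable
      · filter_upwards [self_mem_nhdsWithin] with δ hδ
        refine Eventually.of_forall fun u => ?_
        rw [norm_mul]
        gcongr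
        rw [norm_mul]
        by_cases hu : 0 < u
        · have : ‖Complex.exp (-(δ*u : ℝ))‖ ≤ 1 := by
            rw [← Complex.ofReal_neg, ← Complex.ofReal_exp, Complex.norm_real, Real.norm_eq_abs, Real.abs_exp]
            have : 0 < δ * u := mul_pos hδ hu
            simp only [Real.exp_le_one_iff]; linarith
          have h2 := hh_bound u
          have h3 : ‖(hh u : ℂ)‖ ≤ Real.log 4 + 4 := by simpa using h2
          calc _ ≤ (Real.log 4 + 4) * 1 := by gcongr
            _ = _ := mul_one _
        · have : hh u = 0 := by simp [hh, hu]
          have h4 : 0 ≤ Real.log 4 := Real.log_nonneg (by norm_num)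
          rw [this]; simp; linarith
      · exact iK.norm.const_mul _
      · refine Eventually.of_forall fun u => ?_
        have : Tendsto (fun δ : ℝ => (hh u : ℂ) * Complex.exp (-(δ*u : ℝ)) * 𝓕 φ (u - y)) (nhds 0) (nhds ((hh u : ℂ) * Complex.exp (-((0:ℝ)*u : ℝ)) * 𝓕 φ (u - y))) :=
          (by fun_prop : Continuous fun δ : ℝ => (hh u : ℂ) * Complex.exp (-(δ*u : ℝ)) * 𝓕 φ (u - y)).tendsto 0
        simp only [zero_mul, Complex.ofReal_zero, neg_zero, Complex.exp_zero, mul_one] at this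
        exact this.mono_left nhdsWithin_le_nhds
    have l2 : Tendsto (fun δ : ℝ => ∫ t, ((Real.fourierChar (t * y) : Circle) : ℂ) * φ t * G (1 + (δ : ℂ) + ((2 * Real.pi * t : ℝ) : ℂ) * Complex.I)) (nhdsWithin 0 (Set.Ioi 0)) (nhds (∫ t, ((Real.fourierChar (t * y) : Circle) : ℂ) * φ t * G (1 + ((0:ℝ) : ℂ) + ((2 * Real.pi * t : ℝ) : ℂ) * Complex.I))) := by
      have hcomp : ContinuousOn (fun p : ℝ × ℝ => G (1 + (p.1 : ℂ) + ((2 * Real.pi * p.2 : ℝ) : ℂ) * Complex.I)) (Set.Icc 0 1 ×ˢ tsupport φ) := by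
        refine hGc.comp (by fun_prop) ?_
        rintro ⟨δ, t⟩ ⟨h1, h2⟩
        exact hline δ t h1.1
      obtain ⟨M, hM⟩ := (isCompact_Icc.prod hs).exists_bound_of_continuousOn hcomp
      have hchar := Real.continuous_fourierChar
      refine tendsto_integral_filter_of_dominated_convergence (fun t => ‖φ t‖ * M) ?_ ?_ ?_ ?_
      · filter_upwards [self_mem_nhdsWithin] with δ hδ
        have hδ : 0 < δ := hδ
        have : Continuous fun t : ℝ => G (1 + (δ : ℂ) + ((2 * Real.pi * t : ℝ) : ℂ) * Complex.I) := by
          refine hGc.comp_continuous (by fun_prop) fun t => hline δ t hδ.le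
        have hch2 : Continuous fun t : ℝ => ((Real.fourierChar (t * y) : Circle) : ℂ) := by fun_prop
        exact ((hch2.mul hc).mul this).aestronglyMeasurable
      · filter_upwards [Ioo_mem_nhdsGT (show (0:ℝ) < 1 by norm_num)] with δ hδ
        refine Eventually.of_forall fun t => ?_
        by_cases ht : t ∈ tsupport φ
        · have := hM (δ, t) ⟨⟨hδ.1.le, hδ.2.le⟩, ht⟩
          rw [norm_mul, norm_mul, Circle.norm_coe, one_mul]
          gcongr
        · simp [image_eq_zero_of_notMem_tsupport ht]
      · exact hφi.norm.mul_const _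
      · refine Eventually.of_forall fun t => ?_
        refine Tendsto.mul tendsto_const_nhds ?_
        have : ContinuousOn (fun δ : ℝ => G (1 + (δ : ℂ) + ((2 * Real.pi * t : ℝ) : ℂ) * Complex.I)) (Set.Ici 0) :=
          hGc.comp (by fun_prop) fun δ hδ => hline δ t hδ
        exact (this 0 (by simp)).mono_left (nhdsWithin_mono _ Set.Ioi_subset_Ici_self)
    refine tendsto_nhds_unique l1 (l2.congr' ?_)
    filter_upwards [self_mem_nhdsWithin] with δ hδ
    exact (key y δ hδ).symm
  simp_rw [lim]
  have RL := (Real.tendsto_integral_exp_smul_cocompact (fun t => φ t * G (1 + ((0:ℝ) : ℂ) + ((2 * Real.pi * t : ℝ) : ℂ) * Complex.I)))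
  have := (RL.mono_left (cocompact_eq_atBot_atTop (α := ℝ) ▸ le_sup_left)).comp tendsto_neg_atTop_atBot
  refine this.congr fun y => ?_
  simp only [Function.comp, Circle.smul_def, smul_eq_mul, mul_assoc, mul_neg, neg_neg]


noncomputable def tri (t : ℝ) : ℂ := ((max 0 (1 - |t|) : ℝ) : ℂ)

lemma tri_cont : Continuous tri := by unfold tri; fun_prop

lemma tri_zero {t : ℝ} (h : t ∉ Set.Icc (-1:ℝ) 1) : tri t = 0 := by
  have : 1 < |t| := by
    by_contra hc
    exact h (abs_le.1 (not_lt.1 hc))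
  simp only [tri]
  rw [max_eq_left (by linarith)]; simp

lemma tri_supp : HasCompactSupport tri :=
  HasCompactSupport.intro isCompact_Icc fun _ => tri_zero

lemma tri_half (w : ℂ) (hw : w ≠ 0) : ∫ t in (0:ℝ)..1, Complex.exp (w * t) * (1 - t) = Complex.exp w / w^2 - 1 / w - 1 / w^2 := by
  have := intervalIntegral.integral_eq_sub_of_hasDerivAt (a := 0) (b := 1) (f := fun t : ℝ => Complex.exp (w * t) * (1 - t) / w + Complex.exp (w * t) / w^2) (f' := fun t : ℝ => Complex.exp (w * t) * (1 - t)) ?_ ?_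
  · rw [this]; simp; ring
  · intro t _
    have h1 : HasDerivAt (fun t : ℝ => Complex.exp (w * t)) (Complex.exp (w * t) * w) t := by
      have : HasDerivAt (fun t : ℝ => w * (t : ℂ)) (w * 1) t := (Complex.ofRealCLM.hasDerivAt (x := t)).const_mul w
      rw [mul_one] at this
      exact this.cexp
    have h2 : HasDerivAt (fun t : ℝ => (1 : ℂ) - t) (-1) t := (Complex.ofRealCLM.hasDerivAt (x := t)).const_sub 1
    refine (((h1.mul h2).div_const w).add (h1.div_const (w^2))).congr_deriv ?_
    field_simp
    ring
  · apply Continuous.intervalIntegrable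
    fun_prop

noncomputable def FK (x : ℝ) : ℝ := (1 - Real.cos (2 * Real.pi * x)) / (2 * Real.pi ^ 2 * x ^ 2)

open MeasureTheory in
open scoped FourierTransform in
lemma tri_fourier {x : ℝ} (hx : x ≠ 0) : 𝓕 tri x = (FK x : ℂ) := by
  rw [Real.fourier_real_eq_integral_exp_smul]
  have e1 : ∫ v : ℝ, Complex.exp (↑(-2 * Real.pi * v * x) * Complex.I) • tri v = 
      ∫ v in (-1:ℝ)..1, Complex.exp (↑(-2 * Real.pi * v * x) * Complex.I) • tri v := by
    rw [intervalIntegral.integral_of_le (by norm_num), ← integral_Icc_eq_integral_Ioc]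
    refine (setIntegral_eq_integral_of_forall_compl_eq_zero fun t ht => ?_).symm
    rw [tri_zero ht, smul_zero]
  have hcont : Continuous fun v : ℝ => Complex.exp (↑(-2 * Real.pi * v * x) * Complex.I) • tri v := by
    have := tri_cont
    fun_prop
  set w : ℂ := -(2 * Real.pi * x) * Complex.I with hwdef
  have hw : w ≠ 0 := by
    simp [hwdef, Real.pi_ne_zero, hx]
  rw [e1, ← intervalIntegral.integral_add_adjacent_intervals (b := 0) (hcont.intervalIntegrable _ _) (hcont.intervalIntegrable _ _)]
  have e2 : ∫ v in (0:ℝ)..1, Complex.exp (↑(-2 * Real.pi * v * x) * Complex.I) • tri v = ∫ t in (0:ℝ)..1, Complex.exp (w * t) * (1 - t) := by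
    refine intervalIntegral.integral_congr fun t ht => ?_
    rw [Set.uIcc_of_le (by norm_num)] at ht
    have h1 : tri t = 1 - t := by
      simp only [tri]; rw [abs_of_nonneg ht.1, max_eq_right (by linarith [ht.2])]; simp
    simp only [h1, smul_eq_mul, hwdef]
    push_cast; ring_nf
  have e3 : ∫ v in (-1:ℝ)..0, Complex.exp (↑(-2 * Real.pi * v * x) * Complex.I) • tri v = ∫ t in (0:ℝ)..1, Complex.exp (-w * t) * (1 - t) := by
    have := intervalIntegral.integral_comp_neg (a := 0) (b := 1) (fun v : ℝ => Complex.exp (↑(-2 * Real.pi * v * x) * Complex.I) • tri v)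
    rw [neg_zero] at this
    rw [← this]
    refine intervalIntegral.integral_congr fun t ht => ?_
    rw [Set.uIcc_of_le (by norm_num)] at ht
    have h1 : tri (-t) = 1 - t := by
      simp only [tri]; rw [abs_neg, abs_of_nonneg ht.1, max_eq_right (by linarith [ht.2])]; simp
    simp only [h1, smul_eq_mul, hwdef]
    push_cast; ring_nf
  rw [e2, e3, tri_half _ hw, tri_half _ (neg_ne_zero.2 hw)]
  have hcos : Complex.exp w + Complex.exp (-w) = 2 * Complex.cos (2 * Real.pi * x) := by
    rw [Complex.two_cos, hwdef, neg_mul, neg_neg]; ring_nf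
  have hw2 : w ^ 2 = - (4 * Real.pi^2 * x^2) := by
    rw [hwdef, mul_pow, Complex.I_sq]; ring
  have : Complex.exp (-w) / (-w) ^ 2 - 1 / -w - 1 / (-w) ^ 2 + (Complex.exp w / w ^ 2 - 1 / w - 1 / w ^ 2) = (Complex.exp w + Complex.exp (-w) - 2) / w ^ 2 := by
    field_simp; ring
  rw [this, hcos, hw2, FK]
  have : (x:ℂ) ≠ 0 := by exact_mod_cast hx
  have : (Real.pi:ℂ) ≠ 0 := by exact_mod_cast Real.pi_ne_zero
  push_cast
  field_simp
  ring

lemma FK_nonneg (x : ℝ) : 0 ≤ FK x := by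
  unfold FK
  exact div_nonneg (by linarith [Real.cos_le_one (2 * Real.pi * x)]) (by positivity)

lemma FK_meas : Measurable FK := by unfold FK; fun_prop

lemma FK_le (x : ℝ) : FK x ≤ 2 * (1 + x^2)⁻¹ := by
  unfold FK
  by_cases hx : x = 0
  · simp [hx]
  have hx2 : 0 < x^2 := by positivity
  have hpi := Real.pi_gt_three
  rw [← div_eq_mul_inv, div_le_div_iff₀ (by positivity) (by positivity)]
  have h1 := Real.one_sub_sq_div_two_le_cos (x := 2 * Real.pi * x)
  have h2 := Real.neg_one_le_cos (2 * Real.pi * x)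
  have h3 : 1 - Real.cos (2 * Real.pi * x) ≤ 2 * Real.pi^2 * x^2 := by nlinarith
  nlinarith [mul_le_mul_of_nonneg_right h2 hx2.le, mul_pos hx2 (by linarith : 0 < Real.pi - 1)]

lemma FK_int : MeasureTheory.Integrable FK :=
  (integrable_inv_one_add_sq.const_mul 2).mono' FK_meas.aestronglyMeasurable
    (Eventually.of_forall fun x => by rw [Real.norm_eq_abs, abs_of_nonneg (FK_nonneg x)]; exact FK_le x)

open MeasureTheory in
open scoped FourierTransform in
lemma tri_fourier_ae : 𝓕 tri =ᵐ[volume] fun x => (FK x : ℂ) := by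
  filter_upwards [compl_mem_ae_iff.2 (measure_singleton (0:ℝ))] with x hx
  exact tri_fourier hx

lemma tri_int : MeasureTheory.Integrable tri := tri_cont.integrable_of_hasCompactSupport tri_supp

open MeasureTheory in
open scoped FourierTransform in
lemma tri_fourier_int : Integrable (𝓕 tri) := FK_int.ofReal.congr tri_fourier_ae.symm

open MeasureTheory in
open scoped FourierTransform in
lemma FK_integral : ∫ x, FK x = 1 := by
  have := tri_int.fourierInv_fourier_eq tri_fourier_int (v := 0) tri_cont.continuousAt
  rw [Real.fourierInv_eq] at this
  simp only [inner_zero_right, AddChar.map_zero_eq_one, one_smul] at this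
  rw [integral_congr_ae tri_fourier_ae, integral_complex_ofReal] at this
  simpa [tri] using this

open MeasureTheory in
open scoped FourierTransform in
lemma tri_scale (l : ℝ) (hl : 0 < l) (x : ℝ) : 𝓕 (fun t => tri (t / l)) x = l * 𝓕 tri (l * x) := by
  rw [Real.fourier_real_eq, Real.fourier_real_eq]
  have := Measure.integral_comp_div (fun v => Real.fourierChar (-(v * (l * x))) • tri v) l
  rw [abs_of_pos hl, Complex.real_smul] at this
  rw [← this]
  congr 1
  funext v
  congr 3
  field_simp

open MeasureTheory in
open scoped FourierTransform in
lemma smooth_hh (l : ℝ) (hl : 0 < l) : Tendsto (fun y : ℝ => ∫ x, hh (y + x / l) * FK x) atTop (nhds 0) := by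
  have hK : 𝓕 (fun t => tri (t / l)) = fun x => l * 𝓕 tri (l * x) := by
    funext x; exact tri_scale l hl x
  have h := fourier_side (fun t => tri (t / l)) (tri_cont.comp (by fun_prop)) 
    (tri_supp.comp_homeomorph (Homeomorph.mulRight₀ l⁻¹ (inv_ne_zero hl.ne'))) (by
      rw [hK]
      exact (tri_fourier_int.comp_mul_left' hl.ne').const_mul _)
  have e : ∀ y, ∫ u, (hh u : ℂ) * 𝓕 (fun t => tri (t / l)) (u - y) = ((∫ x, hh (y + x / l) * FK x : ℝ) : ℂ) := by
    intro y
    rw [hK, ← integral_complex_ofReal]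
    have h1 := integral_add_left_eq_self (μ := volume) (fun u : ℝ => (hh u : ℂ) * (l * 𝓕 tri (l * (u - y)))) y
    have h2 := Measure.integral_comp_div (fun u : ℝ => (hh (y + u) : ℂ) * (l * 𝓕 tri (l * (y + u - y)))) l
    rw [abs_of_pos hl, Complex.real_smul, h1] at h2
    have hl' : (l:ℂ) ≠ 0 := by exact_mod_cast hl.ne'
    have h3 : ∫ u, (hh u : ℂ) * (l * 𝓕 tri (l * (u - y))) = (l:ℂ)⁻¹ * ∫ (x : ℝ), (hh (y + x / l) : ℂ) * (l * 𝓕 tri (l * (y + x / l - y))) := by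
      rw [h2, inv_mul_cancel_left₀ hl']
    rw [h3, ← integral_const_mul]
    refine integral_congr_ae ?_
    filter_upwards [tri_fourier_ae] with x hx
    have : l * (y + x / l - y) = x := by field_simp; ring
    rw [this, hx]
    push_cast
    field_simp
  simp_rw [e] at h
  rw [← Complex.ofReal_zero] at h
  exact (Complex.continuous_re.tendsto _).comp h


lemma hB_FK_int (l y : ℝ) : MeasureTheory.Integrable (fun x => hB (y + x / l) * FK x) := by
  refine FK_int.bdd_mul (c := Real.log 4 + 4) ?_ ?_
  · exact (hB_meas.comp (by fun_prop)).aestronglyMeasurable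
  · exact Eventually.of_forall fun u => by simpa [abs_of_nonneg (hB_nonneg _)] using hB_le _

open MeasureTheory in
lemma smooth_hB (l : ℝ) (hl : 0 < l) : Tendsto (fun y : ℝ => ∫ x, hB (y + x / l) * FK x) atTop (nhds 1) := by
  have hi : ∀ y : ℝ, Integrable (fun x : ℝ => (Set.Ioi (0:ℝ)).indicator (fun _ => (1:ℝ)) (y + x / l) * FK x) := by
    intro y
    refine FK_int.bdd_mul (c := 1) ?_ ?_
    · exact ((measurable_const.indicator measurableSet_Ioi).comp (by fun_prop : Measurable fun x : ℝ => y + x / l)).aestronglyMeasurable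
    · refine Eventually.of_forall fun u => ?_
      rw [Set.indicator_apply]; split_ifs <;> simp
  have h1 : Tendsto (fun y : ℝ => ∫ x, (Set.Ioi (0:ℝ)).indicator (fun _ => (1:ℝ)) (y + x / l) * FK x) atTop (nhds (∫ x, FK x)) := by
    refine tendsto_integral_filter_of_dominated_convergence FK (Eventually.of_forall fun y => (hi y).1) ?_ FK_int ?_
    · refine Eventually.of_forall fun y => Eventually.of_forall fun x => ?_
      rw [Set.indicator_apply]; split_ifs <;> simp [abs_of_nonneg, FK_nonneg]
    · refine Eventually.of_forall fun x => ?_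
      refine tendsto_const_nhds.congr' ?_
      filter_upwards [eventually_gt_atTop (-(x/l))] with y hy
      rw [Set.indicator_of_mem (by simp; linarith), one_mul]
  have h2 := (smooth_hh l hl).add h1
  rw [FK_integral, zero_add] at h2
  refine h2.congr fun y => ?_
  have hih : Integrable (fun x => hh (y + x / l) * FK x) := by
    refine FK_int.bdd_mul (c := Real.log 4 + 4) ?_ ?_
    · exact (hh_meas.comp (by fun_prop)).aestronglyMeasurable
    · exact Eventually.of_forall fun u => by simpa using hh_bound _
  rw [← integral_add hih (hi y)]
  congr 1
  funext x
  rw [← add_mul]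
  congr 1
  simp only [hh, Set.indicator_apply]
  split_ifs with h
  · ring
  · rw [hB_neg (by simpa using h)]; simp

lemma hB_slow {y u : ℝ} (h : y ≤ u) : hB y * Real.exp (-(u - y)) ≤ hB u := by
  unfold hB
  rw [mul_assoc, ← Real.exp_add]
  have : -y + -(u - y) = -u := by ring
  rw [this]
  exact mul_le_mul_of_nonneg_right (Chebyshev.psi_mono (Real.exp_le_exp.2 h)) (Real.exp_pos _).le

open MeasureTheory in
lemma hB_bounds (η : ℝ) (h0 : 0 < η) (h1 : η < 1) : ∀ᶠ y in atTop,
    hB y * Real.exp (-(2*η)) * (1 - η) ≤ 1 + η ∧ 1 - η ≤ hB y * Real.exp (2*η) + (Real.log 4 + 4) * η := by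
  have hlim : Tendsto (fun r : ℝ => ∫ x in (-r)..r, FK x) atTop (nhds 1) := by
    have := intervalIntegral_tendsto_integral FK_int tendsto_neg_atTop_atBot (tendsto_id (x := atTop))
    rw [FK_integral] at this
    exact this
  obtain ⟨r, hr, hr0⟩ := ((hlim.eventually_const_lt (show 1 - η < 1 by linarith)).and (eventually_gt_atTop 0)).exists
  rw [intervalIntegral.integral_of_le (by linarith)] at hr
  set S := Set.Ioc (-r) r with hS
  have hSm : MeasurableSet S := measurableSet_Ioc
  set l := r / η with hl
  have hlpos : 0 < l := by positivity
  have habs : ∀ x ∈ S, -η ≤ x / l ∧ x / l ≤ η := by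
    intro x hx
    have : r / l = η := by rw [hl]; field_simp
    rw [← this, ← neg_div]
    exact ⟨div_le_div_of_nonneg_right hx.1.le hlpos.le, div_le_div_of_nonneg_right hx.2 hlpos.le⟩
  have hsplit : (∫ x in S, FK x) + ∫ x in Sᶜ, FK x = 1 := by
    rw [integral_add_compl hSm FK_int, FK_integral]
  have hnn : 0 ≤ ∫ x in Sᶜ, FK x := integral_nonneg fun x => FK_nonneg x
  have hI := smooth_hB l hlpos
  have hIu := (tendsto_atTop_add_const_right atTop η tendsto_id).eventually (hI.eventually_lt_const (show 1 < 1 + η by linarith))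
  have hIl := (tendsto_atTop_add_const_right atTop (-η) tendsto_id).eventually (hI.eventually_const_lt (show 1 - η < 1 by linarith))
  filter_upwards [hIu, hIl] with y hu hl
  simp only [id] at hu hl
  constructor
  · calc hB y * Real.exp (-(2*η)) * (1 - η) ≤ hB y * Real.exp (-(2*η)) * ∫ x in S, FK x := by
          have := hB_nonneg y
          gcongr
      _ = ∫ x in S, hB y * Real.exp (-(2*η)) * FK x := (integral_const_mul _ _).symm
      _ ≤ ∫ x in S, hB (y + η + x / l) * FK x := by
          refine setIntegral_mono_on (FK_int.const_mul _).integrableOn (hB_FK_int _ _).integrableOn hSm fun x hx => ?_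
          have hx' := habs x hx
          refine mul_le_mul_of_nonneg_right ?_ (FK_nonneg x)
          refine le_trans ?_ (hB_slow (show y ≤ y + η + x / l by linarith))
          have := hB_nonneg y
          gcongr
          linarith
      _ ≤ ∫ x, hB (y + η + x / l) * FK x := 
          setIntegral_le_integral (hB_FK_int _ _) (Eventually.of_forall fun x => mul_nonneg (hB_nonneg _) (FK_nonneg _))
      _ ≤ 1 + η := hu.le
  · calc 1 - η ≤ ∫ x, hB (y + -η + x / l) * FK x := hl.le
      _ = (∫ x in S, hB (y + -η + x / l) * FK x) + ∫ x in Sᶜ, hB (y + -η + x / l) * FK x := (integral_add_compl hSm (hB_FK_int _ _)).symm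
      _ ≤ (∫ x in S, hB y * Real.exp (2*η) * FK x) + ∫ x in Sᶜ, (Real.log 4 + 4) * FK x := by
          refine add_le_add ?_ ?_
          · refine setIntegral_mono_on (hB_FK_int _ _).integrableOn (FK_int.const_mul _).integrableOn hSm fun x hx => ?_
            have hx' := habs x hx
            refine mul_le_mul_of_nonneg_right ?_ (FK_nonneg x)
            have h3 := hB_slow (show y + -η + x / l ≤ y by linarith)
            have h4 : Real.exp (-(2*η)) ≤ Real.exp (-(y - (y + -η + x / l))) := Real.exp_le_exp.2 (by linarith)
            have h5 : hB (y + -η + x / l) * Real.exp (-(2*η)) ≤ hB y := 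
              (mul_le_mul_of_nonneg_left h4 (hB_nonneg _)).trans h3
            calc hB (y + -η + x / l) = hB (y + -η + x / l) * Real.exp (-(2*η)) * Real.exp (2*η) := by
                  rw [mul_assoc, ← Real.exp_add]; simp
              _ ≤ _ := by gcongr
          · refine setIntegral_mono_on (hB_FK_int _ _).integrableOn (FK_int.const_mul _).integrableOn hSm.compl fun x hx => ?_
            exact mul_le_mul_of_nonneg_right (hB_le _) (FK_nonneg x)
      _ = hB y * Real.exp (2*η) * (∫ x in S, FK x) + (Real.log 4 + 4) * ∫ x in Sᶜ, FK x := by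
          rw [integral_const_mul, integral_const_mul]
      _ ≤ hB y * Real.exp (2*η) * 1 + (Real.log 4 + 4) * η := by
          have := hB_nonneg y
          have h4 : 0 ≤ Real.log 4 := Real.log_nonneg (by norm_num)
          gcongr
          · linarith
          · linarith
      _ = _ := by rw [mul_one]

lemma hB_tendsto : Tendsto hB atTop (nhds 1) := by
  rw [Metric.tendsto_nhds]
  intro ε hε
  have c1 : Tendsto (fun η : ℝ => (1 + η) * Real.exp (2*η) / (1 - η)) (nhds 0) (nhds 1) := by
    have : ContinuousAt (fun η : ℝ => (1 + η) * Real.exp (2*η) / (1 - η)) 0 := by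
      refine ContinuousAt.div (by fun_prop) (by fun_prop) (by norm_num)
    simpa [ContinuousAt] using this
  have c2 : Tendsto (fun η : ℝ => (1 - η - (Real.log 4 + 4) * η) * Real.exp (-(2*η))) (nhds 0) (nhds 1) := by
    have : Continuous (fun η : ℝ => (1 - η - (Real.log 4 + 4) * η) * Real.exp (-(2*η))) := by fun_prop
    simpa using this.tendsto 0
  have ev := ((c1.eventually_lt_const (show 1 < 1 + ε by linarith)).and (c2.eventually_const_lt (show 1 - ε < 1 by linarith)))
  obtain ⟨η, ⟨e1, e2⟩, h0, h1⟩ := ((ev.filter_mono nhdsWithin_le_nhds).and (Ioo_mem_nhdsGT (show (0:ℝ) < 1 by norm_num))).exists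
  filter_upwards [hB_bounds η h0 h1] with y ⟨b1, b2⟩
  rw [Real.dist_eq, abs_lt]
  have hexp : Real.exp (-(2*η)) * Real.exp (2*η) = 1 := by rw [← Real.exp_add]; simp
  constructor
  · have : (1 - η - (Real.log 4 + 4) * η) * Real.exp (-(2*η)) ≤ hB y := by
      calc _ ≤ (hB y * Real.exp (2*η)) * Real.exp (-(2*η)) := by gcongr; linarith
        _ = hB y * (Real.exp (-(2*η)) * Real.exp (2*η)) := by ring
        _ = _ := by rw [hexp, mul_one]
    linarith
  · have : hB y ≤ (1 + η) * Real.exp (2*η) / (1 - η) := by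
      rw [le_div_iff₀ (by linarith)]
      calc hB y * (1 - η) = hB y * (1 - η) * (Real.exp (-(2*η)) * Real.exp (2*η)) := by rw [hexp, mul_one]
        _ = hB y * Real.exp (-(2*η)) * (1 - η) * Real.exp (2*η) := by ring
        _ ≤ _ := by gcongr
    linarith

lemma psi_tendsto : Tendsto (fun x => Chebyshev.psi x / x) atTop (nhds 1) := by
  refine (hB_tendsto.comp Real.tendsto_log_atTop).congr' ?_
  filter_upwards [eventually_gt_atTop 0] with x hx
  simp only [Function.comp, hB]
  rw [Real.exp_neg, Real.exp_log hx, div_eq_mul_inv]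

lemma theta_tendsto : Tendsto (fun x => Chebyshev.theta x / x) atTop (nhds 1) := by
  have h1 : (Chebyshev.psi - Chebyshev.theta) =o[atTop] (fun x : ℝ => x) := by
    refine Chebyshev.isBigO_psi_sub_theta_sqrt.trans_isLittleO ?_
    refine (Asymptotics.isLittleO_iff_tendsto' (by filter_upwards [eventually_gt_atTop 0] with x hx h; linarith)).2 ?_
    simp_rw [Real.sqrt_div_self']
    exact Real.tendsto_sqrt_atTop.const_div_atTop 1
  have := psi_tendsto.sub h1.tendsto_div_nhds_zero
  simp only [Pi.sub_apply, sub_zero] at this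
  refine this.congr fun x => ?_
  ring

lemma pi_tendsto : Tendsto (fun x : ℝ => (Nat.primeCounting ⌊x⌋₊ : ℝ) * Real.log x / x) atTop (nhds 1) := by
  have h := Chebyshev.integral_theta_div_log_sq_isLittleO.tendsto_div_nhds_zero
  have := theta_tendsto.add h
  rw [add_zero] at this
  refine this.congr' ?_
  filter_upwards [eventually_ge_atTop 2] with x hx
  have : 0 < Real.log x := Real.log_pos (by linarith)
  rw [Chebyshev.primeCounting_eq_theta_div_log_add_integral hx]
  field_simp


lemma loglog_div : Tendsto (fun x : ℝ => Real.log (Real.log x) / Real.log x) atTop (nhds 0) := by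
  have : Tendsto (fun x : ℝ => Real.log x / x) atTop (nhds 0) := 
    Real.isLittleO_log_id_atTop.tendsto_div_nhds_zero
  exact this.comp Real.tendsto_log_atTop

noncomputable def pn (n : ℕ) : ℝ := (Nat.nth Nat.Prime n : ℝ)

lemma pn_atTop : Tendsto pn atTop atTop := by
  refine tendsto_atTop_mono (fun n => ?_) tendsto_natCast_atTop_atTop
  unfold pn
  exact_mod_cast (by have := Nat.add_two_le_nth_prime n; omega : n ≤ Nat.nth Nat.Prime n)

lemma pn_1 : Tendsto (fun n : ℕ => ((n:ℝ)+1) * Real.log (pn n) / pn n) atTop (nhds 1) := by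
  refine (pi_tendsto.comp pn_atTop).congr fun n => ?_
  have : Nat.primeCounting (Nat.nth Nat.Prime n) = n + 1 := by
    rw [Nat.primeCounting, Nat.primeCounting', Nat.count_succ, if_pos (Nat.prime_nth_prime n)]
    have := Nat.primeCounting'_nth_eq n
    rw [Nat.primeCounting'] at this
    rw [this]
  simp only [Function.comp, pn, Nat.floor_natCast, this]
  push_cast
  rfl

lemma pn_2 : Tendsto (fun n : ℕ => Real.log ((n:ℝ)+1) / Real.log (pn n)) atTop (nhds 1) := by
  have h1 := (pn_1.log one_ne_zero)
  rw [Real.log_one] at h1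
  have h2 := h1.div_atTop (Real.tendsto_log_atTop.comp pn_atTop)
  have h3 := (h2.sub (loglog_div.comp pn_atTop)).add_const 1
  simp only [sub_zero, zero_add] at h3
  refine h3.congr' ?_
  filter_upwards [pn_atTop.eventually_gt_atTop 1] with n hn
  have hl : 0 < Real.log (pn n) := Real.log_pos hn
  simp only [Function.comp]
  rw [Real.log_div (by positivity) (by positivity), Real.log_mul (by positivity) hl.ne']
  field_simp
  ring

noncomputable def bn (n : ℕ) : ℝ := ((n:ℝ)+1) * Real.log ((n:ℝ)+1)

lemma bn_atTop : Tendsto bn atTop atTop := by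
  have h : Tendsto (fun n : ℕ => (n:ℝ)+1) atTop atTop := tendsto_atTop_add_const_right _ _ tendsto_natCast_atTop_atTop
  exact h.atTop_mul_atTop₀ (Real.tendsto_log_atTop.comp h)

lemma pn_3 : Tendsto (fun n : ℕ => pn n / bn n) atTop (nhds 1) := by
  have h := (pn_1.mul pn_2).inv₀ (by norm_num)
  simp only [mul_one, inv_one] at h
  refine h.congr' ?_
  filter_upwards [pn_atTop.eventually_gt_atTop 1, eventually_gt_atTop 0] with n hn hn0
  have hl : 0 < Real.log (pn n) := Real.log_pos hn
  have : 0 < Real.log ((n:ℝ)+1) := Real.log_pos (by have : (0:ℝ) < n := by exact_mod_cast hn0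
                                                    linarith)
  unfold bn
  field_simp

noncomputable def fn (n : ℕ) : ℝ := (n:ℝ)^2 * Real.log n / 2
noncomputable def an (n : ℕ) : ℝ := fn (n+1) - fn n

lemma log1 : Tendsto (fun k : ℕ => Real.log ((k:ℝ)+1)) atTop atTop := 
  Real.tendsto_log_atTop.comp (tendsto_atTop_add_const_right _ _ tendsto_natCast_atTop_atTop)

lemma log_diff {k : ℕ} (hk : 0 < k) : 0 ≤ (k:ℝ) * (Real.log ((k:ℝ)+1) - Real.log k) ∧ (k:ℝ) * (Real.log ((k:ℝ)+1) - Real.log k) ≤ 1 := by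
  have hk' : (0:ℝ) < k := by exact_mod_cast hk
  have h1 : Real.log k ≤ Real.log ((k:ℝ)+1) := Real.log_le_log hk' (by linarith)
  constructor
  · exact mul_nonneg hk'.le (by linarith)
  · rw [← Real.log_div (by positivity) (by positivity)]
    have := Real.log_le_sub_one_of_pos (show 0 < ((k:ℝ)+1)/k by positivity)
    calc _ ≤ (k:ℝ) * (((k:ℝ)+1)/k - 1) := by gcongr
      _ = 1 := by field_simp; ring

lemma an_bn : Tendsto (fun n : ℕ => an n / bn n) atTop (nhds 1) := by
  have hq : Tendsto (fun k : ℕ => 1 / ((k:ℝ)+1)) atTop (nhds 0) := tendsto_one_div_add_atTop_nhds_zero_nat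
  have h1 : Tendsto (fun k : ℕ => (k:ℝ) * (Real.log ((k:ℝ)+1) - Real.log k) / Real.log ((k:ℝ)+1)) atTop (nhds 0) := by
    refine squeeze_zero' ?_ ?_ (log1.const_div_atTop 1)
    · filter_upwards [eventually_gt_atTop 0] with k hk
      exact div_nonneg (log_diff hk).1 (Real.log_nonneg (by have : (0:ℝ) ≤ k := by positivity
                                                            linarith))
    · filter_upwards [eventually_gt_atTop 0] with k hk
      exact div_le_div_of_nonneg_right (log_diff hk).2 (Real.log_nonneg (by have : (0:ℝ) ≤ k := by positivity
                                                                            linarith))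
  have h2 := (hq.div_const 2).const_sub 1 |>.add (((hq.const_sub 1).mul h1).div_const 2)
  simp only [zero_div, sub_zero, mul_zero, add_zero] at h2
  refine h2.congr' ?_
  filter_upwards [eventually_gt_atTop 0] with k hk
  have hk' : (0:ℝ) < k := by exact_mod_cast hk
  have : 0 < Real.log ((k:ℝ)+1) := Real.log_pos (by linarith)
  simp only [an, fn, bn]
  push_cast
  field_simp
  ring

lemma fn_mono : Monotone fn := by
  refine monotone_nat_of_le_succ fun n => ?_
  unfold fn
  rcases Nat.eq_zero_or_pos n with rfl | hn
  · simp
  have : (0:ℝ) < n := by exact_mod_cast hn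
  have : 0 ≤ Real.log n := Real.log_natCast_nonneg n
  gcongr <;> simp

lemma fn_atTop : Tendsto fn atTop atTop := by
  have h : Tendsto (fun n : ℕ => (n:ℝ)) atTop atTop := tendsto_natCast_atTop_atTop
  have := ((tendsto_pow_atTop two_ne_zero).comp h).atTop_mul_atTop₀ (Real.tendsto_log_atTop.comp h)
  exact this.atTop_div_const (by norm_num)

lemma fn_pos {n : ℕ} (h : 1 < n) : 0 < fn n := by
  have : (1:ℝ) < n := by exact_mod_cast h
  have := Real.log_pos this
  unfold fn
  positivity

lemma Psum_eq (m : ℕ) : (Psum m : ℝ) = ∑ k ∈ range m, (pn k - 1) := by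
  induction m with
  | zero => simp [Psum]
  | succ n ih =>
    have h : Psum (n+1) = Psum n + (nthPrime (n+1) - 1) := by
      unfold Psum
      rw [Finset.sum_Icc_succ_top (by omega)]
    rw [h, Finset.sum_range_succ, ← ih, Nat.cast_add, Nat.cast_sub (by unfold nthPrime; exact (Nat.prime_nth_prime _).one_le)]
    simp [nthPrime, pn]

lemma Psum_fn : Tendsto (fun m : ℕ => (Psum m : ℝ) / fn m) atTop (nhds 1) := by
  have hc : Tendsto (fun n : ℕ => (pn n - 1) / bn n) atTop (nhds 1) := by
    have := pn_3.sub (bn_atTop.const_div_atTop 1)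
    rw [sub_zero] at this
    refine this.congr fun n => ?_
    ring
  have hca : Tendsto (fun n : ℕ => (pn n - 1 - an n) / an n) atTop (nhds 0) := by
    have := (hc.div an_bn one_ne_zero).sub_const 1
    rw [div_one, sub_self] at this
    refine this.congr' ?_
    filter_upwards [bn_atTop.eventually_gt_atTop 0, an_bn.eventually_const_lt zero_lt_one] with n h1 h2
    have h3 : an n ≠ 0 := by rintro h; simp [h] at h2
    simp only [Pi.div_apply]
    field_simp
  have ha0 : ∀ n, 0 ≤ an n := fun n => sub_nonneg.2 (fn_mono (Nat.le_succ n))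
  have hsum : ∀ n, ∑ i ∈ range n, an i = fn n := by
    intro n
    unfold an
    rw [Finset.sum_range_sub]; simp [fn]
  have hlo : (fun n => pn n - 1 - an n) =o[atTop] an := by
    refine (Asymptotics.isLittleO_iff_tendsto' ?_).2 hca
    filter_upwards [an_bn.eventually_const_lt zero_lt_one] with n h2 h
    simp [h] at h2
  have := hlo.sum_range ha0 (by simp_rw [hsum]; exact fn_atTop)
  simp_rw [hsum] at this
  have h4 := this.tendsto_div_nhds_zero.add_const 1
  rw [zero_add] at h4
  refine h4.congr' ?_
  filter_upwards [eventually_gt_atTop 1] with n hn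
  have := fn_pos hn
  rw [Finset.sum_sub_distrib, hsum, Psum_eq]
  field_simp
  ring

lemma fn_succ : Tendsto (fun m : ℕ => fn (m+1) / fn m) atTop (nhds 1) := by
  have h : Tendsto (fun n : ℕ => (n:ℝ)) atTop atTop := tendsto_natCast_atTop_atTop
  have h1 : Tendsto (fun k : ℕ => 1 + 1 / (k:ℝ)) atTop (nhds 1) := by
    simpa using (h.const_div_atTop 1).const_add 1
  have h2 := (h1.log one_ne_zero).div_atTop (Real.tendsto_log_atTop.comp h)
  have h3 := (h1.pow 2).mul (h2.const_add 1)
  simp only [one_pow, add_zero, mul_one] at h3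
  refine h3.congr' ?_
  filter_upwards [eventually_gt_atTop 1] with n hn
  have hn' : (1:ℝ) < n := by exact_mod_cast hn
  have := Real.log_pos hn'
  have e : 1 + 1 / (n:ℝ) = (n+1) / n := by field_simp
  simp only [Function.comp, fn]
  rw [e, Real.log_div (by positivity) (by positivity)]
  push_cast
  field_simp
  ring

lemma Psum_mono : Monotone Psum := by
  intro a b h
  unfold Psum
  exact Finset.sum_le_sum_of_subset (Finset.Icc_subset_Icc_right h)

/-- If `m(N)` is the unique natural number with
`P(m(N)) ≤ N < P(m(N)+1)`, then `m(N) = (2 + o(1)) · √(N/ln N)` as `N → ∞`. -/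
theorem m_asymp_N (m : ℕ → ℕ)
    (hm : ∀ N : ℕ, Psum (m N) ≤ N ∧ N < Psum (m N + 1)) :
    Filter.Tendsto (fun N : ℕ => (m N : ℝ) / Real.sqrt ((N : ℝ) / Real.log N))
      Filter.atTop (nhds 2) := by
  have hmt : Tendsto m atTop atTop := by
    rw [tendsto_atTop]
    intro M
    filter_upwards [eventually_ge_atTop (Psum M)] with N hN
    by_contra hlt
    have h1 := Psum_mono (show m N + 1 ≤ M by omega)
    have := (hm N).2
    omega
  have hmR : Tendsto (fun N => (m N : ℝ)) atTop atTop := tendsto_natCast_atTop_atTop.comp hmt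
  have hN : Tendsto (fun N : ℕ => (N:ℝ) / fn (m N)) atTop (nhds 1) := by
    have u1 := ((Psum_fn.comp (tendsto_add_atTop_nat 1)).mul fn_succ).comp hmt
    rw [mul_one] at u1
    refine tendsto_of_tendsto_of_tendsto_of_le_of_le' (Psum_fn.comp hmt) u1 ?_ ?_
    · filter_upwards [hmt.eventually_gt_atTop 1] with N h
      have := fn_pos h
      simp only [Function.comp]
      gcongr
      exact_mod_cast (hm N).1
    · filter_upwards [hmt.eventually_gt_atTop 1] with N h
      have := fn_pos h
      have := fn_pos (show 1 < m N + 1 by omega)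
      simp only [Function.comp]
      rw [div_mul_div_cancel₀ this.ne']
      gcongr
      exact_mod_cast (hm N).2.le
  have hlogm := Real.tendsto_log_atTop.comp hmR
  have hL : Tendsto (fun N : ℕ => Real.log N / Real.log (m N)) atTop (nhds 2) := by
    have h1 := hN.log one_ne_zero
    have h2 := h1.div_atTop hlogm
    have h3 := ((h2.add (loglog_div.comp hmR)).sub (hlogm.const_div_atTop (Real.log 2))).add_const 2
    simp only [add_zero, sub_zero, zero_add] at h3
    refine h3.congr' ?_
    filter_upwards [hmt.eventually_gt_atTop 1, eventually_gt_atTop 0] with N h h0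
    have hm' : (1:ℝ) < m N := by exact_mod_cast h
    have hl := Real.log_pos hm'
    have h0' : (0:ℝ) < N := by exact_mod_cast h0
    simp only [Function.comp]
    rw [Real.log_div h0'.ne' (fn_pos h).ne', fn, Real.log_div (by positivity) (by norm_num), Real.log_mul (by positivity) hl.ne', Real.log_pow]
    field_simp
    push_cast
    ring
  have h4 : Tendsto (fun N : ℕ => (m N : ℝ)^2 * (Real.log N / N)) atTop (nhds 4) := by
    have := ((hN.inv₀ one_ne_zero).mul hL).const_mul 2
    norm_num at this
    refine this.congr' ?_
    filter_upwards [hmt.eventually_gt_atTop 1, eventually_gt_atTop 0] with N h h0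
    have hm' : (1:ℝ) < m N := by exact_mod_cast h
    have hl := Real.log_pos hm'
    have h0' : (0:ℝ) < N := by exact_mod_cast h0
    unfold fn
    field_simp
  have h5 := h4.sqrt
  rw [show (4:ℝ) = 2^2 by norm_num, Real.sqrt_sq (by norm_num)] at h5
  refine h5.congr fun N => ?_
  rw [Real.sqrt_mul (by positivity), Real.sqrt_sq (by positivity), div_eq_mul_inv (m N : ℝ), ← Real.sqrt_inv, inv_div]
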